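/- Let U, Y be reflexive Banach spaces, Z a real Hilbert space, U_ad ⊆ U nonempty, closed, convex, A : U → Y and B : U → Z bounded linear operators, and let F : U_ad × U_ad → ℝ ∪ {+∞}, G : Y × U_ad → ℝ ∪ {+∞} satisfy: for all sequences u_ℓ ⇀ u in U_ad and v_ℓ → v strongly, F(u,u) ≤ liminf_ℓ F(u_ℓ,u_ℓ), limsup_ℓ F(v_ℓ,u_ℓ) ≤ F(v,u), G(Au,u) ≤ liminf_ℓ G(Au_ℓ,u_ℓ), limsup_ℓ G(Av_ℓ,u_ℓ) ≤ G(Av,u). Let H : Z × U → ℝ ∪ {+∞} be bounded from below with: for all z_ℓ ⇀ z and u_ℓ ⇀ u, H(z,u) ≤ liminf_ℓ H(z_ℓ,u_ℓ); and for every u_ℓ ⇀ u and z ∈ Z there is z_ℓ → z strongly with limsup_ℓ H(z_ℓ,u_ℓ) ≤ H(z,u). Let (U_ℓ) be subspaces with U_ℓ ⊆ U_{ℓ+1} ⊆ U, U_ad ∩ U_ℓ ≠ ∅, the domain of F(·,u_ℓ) + G(A·,u_ℓ) nonempty for all u_ℓ ∈ U_ad ∩ U_ℓ, and U equal to the closure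 of U_ad ∩ ⋃_ℓ U_ℓ. For fixed γ > 0 define E(v,u) := F(v,u) + G(Av,u) + MY(γ, H(·,u))(Bv) and E_ℓ(v,u) := E(v,u) + I_{U_ℓ}(v). Then (E_ℓ) Mosco-converges to E. -/

import Mathlib

open Filter Topology

noncomputable section

/-- Weak convergence of a sequence in a normed space, tested against all
continuous linear functionals. -/
def WeakConv {U : Type*} [NormedAddCommGroup U] [NormedSpace ℝ U]
    (u : ℕ → U) (x : U) : Prop :=
  ∀ f : U →L[ℝ] ℝ, Tendsto (fun n => f (u n)) atTop (𝓝 (f x))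

/-- The Moreau–Yosida regularization
`MY γ H z = inf_{ζ} ( H ζ + (γ/2) ‖ζ - z‖² )`. -/
def MY {Z : Type*} [NormedAddCommGroup Z] (γ : ℝ) (H : Z → EReal) (z : Z) : EReal :=
  ⨅ ζ : Z, H ζ + ((γ / 2 * ‖ζ - z‖ ^ 2 : ℝ) : EReal)

open Classical in
/-- Indicator function of a set: `0` on the set and `+∞` elsewhere. -/
def indE {X : Type*} (S : Set X) (x : X) : EReal :=
  if x ∈ S then 0 else ⊤

/-- Mosco convergence of a sequence of equilibrium functionals on `U_ad × U_ad`. -/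
def MoscoBiv {U : Type*} [NormedAddCommGroup U] [NormedSpace ℝ U]
    (Uad : Set U) (En : ℕ → U → U → EReal) (E : U → U → EReal) : Prop :=
  (∀ (u : ℕ → U) (x : U), (∀ n, u n ∈ Uad) → x ∈ Uad → WeakConv u x →
      E x x ≤ liminf (fun n => En n (u n) (u n)) atTop) ∧
  (∀ (u : ℕ → U) (x : U), (∀ n, u n ∈ Uad) → x ∈ Uad → WeakConv u x →
    ∀ v ∈ Uad, ∃ w : ℕ → U, (∀ n, w n ∈ Uad) ∧ Tendsto w atTop (𝓝 v) ∧
      limsup (fun n => En n (w n) (u n)) atTop ≤ E v x)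

theorem aux_weak_bdd {U : Type*} [NormedAddCommGroup U] [NormedSpace ℝ U]
    {u : ℕ → U} {x : U} (h : WeakConv u x) : ∃ C, ∀ n, ‖u n‖ ≤ C := by
  have := banach_steinhaus (g := fun n => NormedSpace.inclusionInDoubleDual ℝ U (u n)) (by
    intro f
    obtain ⟨C, hC⟩ := (Metric.isBounded_range_of_tendsto _ (h f)).exists_norm_le
    exact ⟨C, fun n => by simpa using hC _ ⟨n, rfl⟩⟩)
  obtain ⟨C, hC⟩ := this
  refine ⟨C, fun n => ?_⟩
  have h2 := (NormedSpace.inclusionInDoubleDualLi ℝ (E := U)).norm_map (u n)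
  rw [← h2]
  exact hC n

theorem aux_weak_comp {Z : Type*} [NormedAddCommGroup Z] [InnerProductSpace ℝ Z] [CompleteSpace Z]
    {z : ℕ → Z} {C : ℝ} (hz : ∀ n, ‖z n‖ ≤ C) :
    ∃ (x : Z) (φ : ℕ → ℕ), StrictMono φ ∧ WeakConv (fun n => z (φ n)) x := by
  let S : Submodule ℝ Z := (Submodule.span ℝ (Set.range z)).topologicalClosure
  have hS : IsClosed (S : Set Z) := Submodule.isClosed_topologicalClosure _
  haveI : CompleteSpace S := hS.completeSpace_coe
  haveI : TopologicalSpace.SeparableSpace S := by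
    have h1 : TopologicalSpace.IsSeparable (S : Set Z) := by
      rw [Submodule.topologicalClosure_coe]
      exact ((Set.countable_range z).isSeparable.span).closure
    exact h1.separableSpace
  have hmem : ∀ n, z n ∈ S := fun n =>
    Submodule.le_topologicalClosure _ (Submodule.subset_span ⟨n, rfl⟩)
  let y : ℕ → S := fun n => ⟨z n, hmem n⟩
  have hsc := WeakDual.isSeqCompact_closedBall ℝ S (0 : StrongDual ℝ S) C
  obtain ⟨f, -, φ, hφ, hlim⟩ := hsc
    (x := fun n => StrongDual.toWeakDual (InnerProductSpace.toDual ℝ S (y n))) (by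
      intro n
      simp only [Set.mem_preimage, mem_closedBall_zero_iff]
      have : ‖InnerProductSpace.toDual ℝ S (y n)‖ ≤ C := by
        rw [LinearIsometryEquiv.norm_map]; exact hz n
      exact this)
  let x : S := (InnerProductSpace.toDual ℝ S).symm (WeakDual.toStrongDual f)
  refine ⟨x, φ, hφ, fun g => ?_⟩
  let gS : StrongDual ℝ S := g.comp S.subtypeL
  let w : S := (InnerProductSpace.toDual ℝ S).symm gS
  have hw : ∀ s : S, g s = inner ℝ s w := by
    intro s
    have : inner ℝ w s = gS s := InnerProductSpace.toDual_symm_apply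
    rw [real_inner_comm, this]; rfl
  have h3 := ((WeakDual.eval_continuous w).tendsto f).comp hlim
  have h4 : f w = g x := by
    rw [hw]
    exact (InnerProductSpace.toDual_symm_apply (𝕜 := ℝ) (x := w) (y := WeakDual.toStrongDual f)).symm
  rw [← h4]
  refine h3.congr fun n => ?_
  exact (hw (y (φ n))).symm

theorem aux_limsup_add {a b : ℕ → EReal} {a0 b0 : EReal}
    (ha : limsup a atTop ≤ a0) (hb : limsup b atTop ≤ b0) (ha0 : a0 ≠ ⊥) (hb0 : b0 ≠ ⊥) :
    limsup (fun n => a n + b n) atTop ≤ a0 + b0 := by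
  by_cases h1 : a0 = ⊤
  · rw [h1, EReal.top_add_of_ne_bot hb0]; exact le_top
  by_cases h2 : b0 = ⊤
  · rw [h2, EReal.add_top_of_ne_bot ha0]; exact le_top
  have h1' := (ha.trans_lt (lt_top_iff_ne_top.2 h1)).ne
  have h2' := (hb.trans_lt (lt_top_iff_ne_top.2 h2)).ne
  exact (EReal.limsup_add_le (.inr h2') (.inl h1')).trans (add_le_add ha hb)

theorem aux_liminf_add {a b : ℕ → EReal} {a0 b0 : EReal}
    (ha : a0 ≤ liminf a atTop) (hb : b0 ≤ liminf b atTop) :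
    a0 + b0 ≤ liminf (fun n => a n + b n) atTop :=
  (add_le_add ha hb).trans EReal.le_liminf_add

theorem aux_MY_liminf {U Z : Type*} [NormedAddCommGroup U] [NormedSpace ℝ U]
    [NormedAddCommGroup Z] [InnerProductSpace ℝ Z] [CompleteSpace Z]
    (B : U →L[ℝ] Z) (H : Z → U → EReal)
    (hHbdd : ∃ c : ℝ, ∀ z u, (c : EReal) ≤ H z u)
    (hH1 : ∀ (z : ℕ → Z) (z₀ : Z) (u : ℕ → U) (u₀ : U), WeakConv z z₀ → WeakConv u u₀ →
      H z₀ u₀ ≤ liminf (fun ℓ => H (z ℓ) (u ℓ)) atTop)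
    (γ : ℝ) (hγ : 0 < γ) (u : ℕ → U) (x : U) (hu : WeakConv u x) :
    MY γ (fun z => H z x) (B x) ≤ liminf (fun n => MY γ (fun z => H z (u n)) (B (u n))) atTop := by
  by_contra! hlt
  obtain ⟨M, hM1, hM2⟩ := EReal.lt_iff_exists_real_btwn.1 hlt
  obtain ⟨φ, hφ, hφM⟩ := extraction_of_frequently_atTop (frequently_lt_of_liminf_lt (by isBoundedDefault) hM1)
  have : ∀ n, ∃ ζ, H ζ (u (φ n)) + ((γ / 2 * ‖ζ - B (u (φ n))‖ ^ 2 : ℝ) : EReal) < M :=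
    fun n => iInf_lt_iff.1 (hφM n)
  choose ζ hζ using this
  obtain ⟨c, hc⟩ := hHbdd
  obtain ⟨C, hC⟩ := aux_weak_bdd hu
  have hbd : ∀ n, ‖ζ n‖ ≤ (1 + (M - c) / (γ / 2)) + ‖B‖ * C := by
    intro n
    have h1 : ((c + γ / 2 * ‖ζ n - B (u (φ n))‖ ^ 2 : ℝ) : EReal) < M := by
      rw [EReal.coe_add]
      exact (add_le_add (hc _ _) le_rfl).trans_lt (hζ n)
    have h2 := EReal.coe_lt_coe_iff.1 h1
    have h3 : ‖ζ n - B (u (φ n))‖ ^ 2 ≤ (M - c) / (γ / 2) := by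
      rw [le_div_iff₀ (by positivity)]; linarith
    have h4 : ‖B (u (φ n))‖ ≤ ‖B‖ * C :=
      (B.le_opNorm _).trans (mul_le_mul_of_nonneg_left (hC _) (norm_nonneg _))
    have h5 : ‖ζ n‖ ≤ ‖ζ n - B (u (φ n))‖ + ‖B (u (φ n))‖ := by
      simpa using norm_add_le (ζ n - B (u (φ n))) (B (u (φ n)))
    nlinarith [sq_nonneg (‖ζ n - B (u (φ n))‖ - 1), norm_nonneg (ζ n - B (u (φ n)))]
  obtain ⟨ζ₀, ψ, hψ, hw⟩ := aux_weak_comp hbd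
  have hu' : WeakConv (fun n => u (φ (ψ n))) x := fun f =>
    (hu f).comp ((hφ.comp hψ).tendsto_atTop)
  have hH := hH1 _ _ _ _ hw hu'
  set d := ζ₀ - B x with hd
  let r : ℕ → ℝ := fun n => γ / 2 * (2 * inner ℝ d (ζ (ψ n) - B (u (φ (ψ n)))) - ‖d‖ ^ 2)
  have hr : Tendsto r atTop (𝓝 (γ / 2 * ‖d‖ ^ 2)) := by
    have e1 := hw (innerSL ℝ d)
    have e2 := hu' ((innerSL ℝ d).comp B)
    have e3 := (((e1.sub e2).const_mul 2).sub_const (‖d‖ ^ 2)).const_mul (γ / 2)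
    have e4 : γ / 2 * ‖d‖ ^ 2 = γ / 2 * (2 * (innerSL ℝ d ζ₀ - ((innerSL ℝ d).comp B) x) - ‖d‖ ^ 2) := by
      have : innerSL ℝ d ζ₀ - ((innerSL ℝ d).comp B) x = ‖d‖ ^ 2 := by
        rw [← real_inner_self_eq_norm_sq]
        exact (inner_sub_right d ζ₀ (B x)).symm
      rw [this]; ring
    rw [e4]
    refine e3.congr fun n => ?_
    simp [r, inner_sub_right]
  have hr' : ((γ / 2 * ‖d‖ ^ 2 : ℝ) : EReal) ≤ liminf (fun n => (r n : EReal)) atTop :=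
    ((continuous_coe_real_ereal.tendsto _).comp hr).liminf_eq.ge
  have h1 := aux_liminf_add hH hr'
  have h2 : liminf (fun n => H (ζ (ψ n)) (u (φ (ψ n))) + (r n : EReal)) atTop ≤ M := by
    refine (liminf_le_liminf (v := fun _ => (M : EReal)) (Eventually.of_forall fun n => ?_)).trans
      (liminf_const _).le
    refine le_trans (add_le_add le_rfl (EReal.coe_le_coe_iff.2 ?_)) (hζ (ψ n)).le
    have h := norm_sub_sq_real d (ζ (ψ n) - B (u (φ (ψ n))))
    have := sq_nonneg ‖d - (ζ (ψ n) - B (u (φ (ψ n))))‖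
    exact mul_le_mul_of_nonneg_left (by linarith) (by positivity)
  have h3 : MY γ (fun z => H z x) (B x) ≤ M := (iInf_le _ ζ₀).trans (h1.trans h2)
  exact absurd hM2 h3.not_gt

theorem aux_MY_limsup {U Z : Type*} [NormedAddCommGroup U] [NormedSpace ℝ U]
    [NormedAddCommGroup Z] [InnerProductSpace ℝ Z]
    (B : U →L[ℝ] Z) (H : Z → U → EReal)
    (hHbot : ∀ z u, H z u ≠ ⊥)
    (hH2 : ∀ (u : ℕ → U) (u₀ : U), WeakConv u u₀ → ∀ z₀ : Z, ∃ z : ℕ → Z,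
      Tendsto z atTop (𝓝 z₀) ∧ limsup (fun ℓ => H (z ℓ) (u ℓ)) atTop ≤ H z₀ u₀)
    (γ : ℝ) (u : ℕ → U) (x : U) (hu : WeakConv u x) (w : ℕ → U) (v : U)
    (hw : Tendsto w atTop (𝓝 v)) :
    limsup (fun n => MY γ (fun z => H z (u n)) (B (w n))) atTop ≤ MY γ (fun z => H z x) (B v) := by
  refine le_iInf fun ζ => ?_
  obtain ⟨z, hz, hzH⟩ := hH2 u x hu ζ
  have hr : Tendsto (fun n => γ / 2 * ‖z n - B (w n)‖ ^ 2) atTop (𝓝 (γ / 2 * ‖ζ - B v‖ ^ 2)) :=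
    ((hz.sub ((B.continuous.tendsto v).comp hw)).norm.pow 2).const_mul _
  have hr' : limsup (fun n => ((γ / 2 * ‖z n - B (w n)‖ ^ 2 : ℝ) : EReal)) atTop
      ≤ ((γ / 2 * ‖ζ - B v‖ ^ 2 : ℝ) : EReal) :=
    ((continuous_coe_real_ereal.tendsto _).comp hr).limsup_eq.le
  refine le_trans (limsup_le_limsup (Eventually.of_forall fun n => iInf_le _ (z n)))
    (aux_limsup_add hzH hr' (hHbot _ _) (EReal.coe_ne_bot _))

theorem aux_dense {U : Type*} [NormedAddCommGroup U] [NormedSpace ℝ U]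
    (Usub : ℕ → Submodule ℝ U) (hmono : ∀ ℓ, Usub ℓ ≤ Usub (ℓ + 1)) (v : U)
    (hv : v ∈ closure (⋃ ℓ, (Usub ℓ : Set U))) :
    ∃ w : ℕ → U, (∀ n, w n ∈ Usub n) ∧ Tendsto w atTop (𝓝 v) := by
  have hm : Monotone Usub := monotone_nat_of_le_succ hmono
  have hne : ∀ n, (Usub n : Set U).Nonempty := fun n => ⟨0, (Usub n).zero_mem⟩
  have : ∀ n : ℕ, ∃ p ∈ (Usub n : Set U), dist v p < Metric.infDist v (Usub n : Set U) + 1 / ((n : ℝ) + 1) :=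
    fun n => (Metric.infDist_lt_iff (hne n)).1 (lt_add_of_pos_right _ (by positivity))
  choose w hw hd using this
  refine ⟨w, hw, ?_⟩
  have h0 : Tendsto (fun n => Metric.infDist v (Usub n : Set U)) atTop (𝓝 0) := by
    rw [Metric.tendsto_atTop]
    intro ε hε
    obtain ⟨y, hy, hyd⟩ := Metric.mem_closure_iff.1 hv ε hε
    obtain ⟨N, hN⟩ := Set.mem_iUnion.1 hy
    refine ⟨N, fun n hn => ?_⟩
    rw [Real.dist_eq, sub_zero, abs_of_nonneg Metric.infDist_nonneg]
    exact (Metric.infDist_le_dist_of_mem (hm hn hN)).trans_lt hyd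
  have h1 := h0.add (tendsto_one_div_add_atTop_nhds_zero_nat (𝕜 := ℝ))
  rw [add_zero] at h1
  rw [tendsto_iff_dist_tendsto_zero]
  exact squeeze_zero (fun _ => dist_nonneg) (fun n => by rw [dist_comm]; exact (hd n).le) h1

/-- for fixed regularization parameter `γ > 0`, the discretized
regularized equilibrium functionals
`E_ℓ(v,u) = F(v,u) + G(Av,u) + MY(γ, H(·,u))(Bv) + I_{U_ℓ}(v)` Mosco-converge to
`E(v,u) = F(v,u) + G(Av,u) + MY(γ, H(·,u))(Bv)`. -/
theorem stmt7 {U Y Z : Type*}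
    [NormedAddCommGroup U] [NormedSpace ℝ U] [CompleteSpace U]
    [NormedAddCommGroup Y] [NormedSpace ℝ Y] [CompleteSpace Y]
    [NormedAddCommGroup Z] [InnerProductSpace ℝ Z] [CompleteSpace Z]
    (hreflU : Function.Surjective ⇑(NormedSpace.inclusionInDoubleDual ℝ U))
    (hreflY : Function.Surjective ⇑(NormedSpace.inclusionInDoubleDual ℝ Y))
    (Uad : Set U) (hUne : Uad.Nonempty) (hUcl : IsClosed Uad) (hUconv : Convex ℝ Uad)
    (A : U →L[ℝ] Y) (B : U →L[ℝ] Z)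
    (F : U → U → EReal) (G : Y → U → EReal) (H : Z → U → EReal)
    (hFbot : ∀ v u, F v u ≠ ⊥) (hGbot : ∀ y u, G y u ≠ ⊥)
    -- sequential semicontinuity conditions on `F` and `G`
    (hF1 : ∀ (u : ℕ → U) (u₀ : U), (∀ ℓ, u ℓ ∈ Uad) → u₀ ∈ Uad → WeakConv u u₀ →
      F u₀ u₀ ≤ liminf (fun ℓ => F (u ℓ) (u ℓ)) atTop)
    (hF2 : ∀ (u : ℕ → U) (u₀ : U) (v : ℕ → U) (v₀ : U),
      (∀ ℓ, u ℓ ∈ Uad) → u₀ ∈ Uad → WeakConv u u₀ → Tendsto v atTop (𝓝 v₀) →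
      limsup (fun ℓ => F (v ℓ) (u ℓ)) atTop ≤ F v₀ u₀)
    (hG1 : ∀ (u : ℕ → U) (u₀ : U), (∀ ℓ, u ℓ ∈ Uad) → u₀ ∈ Uad → WeakConv u u₀ →
      G (A u₀) u₀ ≤ liminf (fun ℓ => G (A (u ℓ)) (u ℓ)) atTop)
    (hG2 : ∀ (u : ℕ → U) (u₀ : U) (v : ℕ → U) (v₀ : U),
      (∀ ℓ, u ℓ ∈ Uad) → u₀ ∈ Uad → WeakConv u u₀ → Tendsto v atTop (𝓝 v₀) →
      limsup (fun ℓ => G (A (v ℓ)) (u ℓ)) atTop ≤ G (A v₀) u₀)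
    -- conditions on `H`
    (hHbot : ∀ z u, H z u ≠ ⊥)
    (hHbdd : ∃ c : ℝ, ∀ z u, (c : EReal) ≤ H z u)
    (hH1 : ∀ (z : ℕ → Z) (z₀ : Z) (u : ℕ → U) (u₀ : U), WeakConv z z₀ → WeakConv u u₀ →
      H z₀ u₀ ≤ liminf (fun ℓ => H (z ℓ) (u ℓ)) atTop)
    (hH2 : ∀ (u : ℕ → U) (u₀ : U), WeakConv u u₀ → ∀ z₀ : Z, ∃ z : ℕ → Z,
      Tendsto z atTop (𝓝 z₀) ∧ limsup (fun ℓ => H (z ℓ) (u ℓ)) atTop ≤ H z₀ u₀)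
    -- the sequence of subspaces
    (Usub : ℕ → Submodule ℝ U)
    (hmono : ∀ ℓ, Usub ℓ ≤ Usub (ℓ + 1))
    (hinter : ∀ ℓ, (Uad ∩ (Usub ℓ : Set U)).Nonempty)
    (hdom : ∀ ℓ, ∀ uℓ ∈ Uad ∩ (Usub ℓ : Set U), ∃ v, F v uℓ + G (A v) uℓ ≠ ⊤)
    (hdense : closure (Uad ∩ ⋃ ℓ, (Usub ℓ : Set U)) = Set.univ)
    (γ : ℝ) (hγ : 0 < γ) :
    MoscoBiv Uad
      (fun ℓ v u => (F v u + G (A v) u + MY γ (fun z => H z u) (B v)) +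
        indE (Usub ℓ : Set U) v)
      (fun v u => F v u + G (A v) u + MY γ (fun z => H z u) (B v)) := by
  have huniv : Uad = Set.univ := by
    refine Set.eq_univ_of_univ_subset ?_
    rw [← hdense]
    exact closure_minimal Set.inter_subset_left hUcl
  have hMYbot : ∀ v x, MY γ (fun z => H z x) (B v) ≠ ⊥ := by
    intro v x
    obtain ⟨c, hc⟩ := hHbdd
    have : (c : EReal) ≤ MY γ (fun z => H z x) (B v) := by
      refine le_iInf fun ζ => ?_
      have h0 : (0 : EReal) ≤ ((γ / 2 * ‖ζ - B v‖ ^ 2 : ℝ) : EReal) :=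
        EReal.coe_nonneg.2 (by positivity)
      simpa using add_le_add (hc ζ x) h0
    exact ((EReal.bot_lt_coe c).trans_le this).ne'
  refine ⟨fun u x hu hx hux => ?_, fun u x hu hx hux v hv => ?_⟩
  · have h := aux_liminf_add (aux_liminf_add (hF1 u x hu hx hux) (hG1 u x hu hx hux))
      (aux_MY_liminf B H hHbdd hH1 γ hγ u x hux)
    refine h.trans (liminf_le_liminf (Eventually.of_forall fun n => ?_))
    have h0 : (0 : EReal) ≤ indE (Usub n : Set U) (u n) := by
      unfold indE; split_ifs <;> simp
    simpa using add_le_add (le_refl (F (u n) (u n) + G (A (u n)) (u n) +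
      MY γ (fun z => H z (u n)) (B (u n)))) h0
  · have hvc : v ∈ closure (⋃ ℓ, (Usub ℓ : Set U)) :=
      closure_mono Set.inter_subset_right (hdense ▸ Set.mem_univ v)
    obtain ⟨w, hw, hwv⟩ := aux_dense Usub hmono v hvc
    refine ⟨w, fun n => huniv ▸ Set.mem_univ _, hwv, ?_⟩
    have hFG : F v x + G (A v) x ≠ ⊥ := by
      simp [EReal.add_eq_bot_iff, hFbot, hGbot]
    have h := aux_limsup_add (aux_limsup_add (hF2 u x w v hu hx hux hwv)
      (hG2 u x w v hu hx hux hwv) (hFbot _ _) (hGbot _ _))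
      (aux_MY_limsup B H hHbot hH2 γ u x hux w v hwv) hFG (hMYbot v x)
    refine le_trans (le_of_eq ?_) h
    congr 1
    funext n
    have : indE (Usub n : Set U) (w n) = 0 := if_pos (hw n)
    simp only [this, add_zero]
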